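/- arXiv:1506.06703 — 4 statements merged into one kernel-verified Lean document; each statement's English description precedes it below -/
import Mathlib

section
/- Let p be a prime and let M be a finitely generated module over the power series ring ℤ_p[[X]] over the p-adic integers. Suppose the X-torsion submodule M[X] = {m ∈ M : X·m = 0} is finite as a set. Then there is a single natural number k such that p^k annihilates M[X^n] = {m ∈ M : X^n·m = 0} for every n ≥ 1; that is, a uniform power of p, independent of n, kills all the X^n-torsion of M. -/
open PowerSeries in
/-- A finite module over `ℤ_p⟦X⟧` is annihilated by a power of `p`. -/
theorem exists_pow_smul_eq_zero_of_finite (p : ℕ) [Fact p.Prime]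
    (N : Type*) [AddCommGroup N] [Module (PowerSeries ℤ_[p]) N] [Finite N] :
    ∃ a : ℕ, ∀ m : N, ((p : PowerSeries ℤ_[p]) ^ a) • m = 0 := by
  have hcard : (Nat.card N : ℤ_[p]) ≠ 0 := Nat.cast_ne_zero.mpr Nat.card_pos.ne'
  refine ⟨(Nat.card N : ℤ_[p]).valuation, fun m => ?_⟩
  have hspec := congrArg (C (R := ℤ_[p])) (PadicInt.unitCoeff_spec hcard)
  simp only [map_natCast, map_mul, map_pow] at hspec
  have hzero : (Nat.card N : PowerSeries ℤ_[p]) • m = 0 := by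
    rw [Nat.cast_smul_eq_nsmul, card_nsmul_eq_zero']
  rw [hspec, mul_smul] at hzero
  exact (((PadicInt.unitCoeff hcard).isUnit.map (C (R := ℤ_[p]))).smul_eq_zero).mp hzero

/-- If `r` annihilates the `x`-torsion of a module, then `r ^ n` annihilates its
`x ^ n`-torsion. -/
theorem pow_smul_eq_zero_of_pow_smul_eq_zero {R M : Type*} [CommRing R] [AddCommGroup M]
    [Module R M] {r x : R} (h : ∀ m : M, x • m = 0 → r • m = 0) (n : ℕ) (m : M)
    (hm : x ^ n • m = 0) : r ^ n • m = 0 := by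
  induction n generalizing m with
  | zero => simpa using hm
  | succ n ih =>
    rw [pow_succ, mul_smul]
    refine ih _ ?_
    rw [smul_comm]
    refine h _ ?_
    rwa [← mul_smul, ← pow_succ']

/-- if `M` is a finitely generated module over `ℤ_p[[X]]` whose
`X`-torsion `M[X]` is finite, then a single power `p^k` annihilates `M[Xⁿ]` for
every `n ≥ 1`. -/
theorem uniform_annihilation_of_X_power_torsion (p : ℕ) [Fact p.Prime]
    (M : Type*) [AddCommGroup M] [Module (PowerSeries ℤ_[p]) M]
    [Module.Finite (PowerSeries ℤ_[p]) M]
    (hfin : {m : M | (PowerSeries.X : PowerSeries ℤ_[p]) • m = 0}.Finite) :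
    ∃ k : ℕ, ∀ n : ℕ, 1 ≤ n → ∀ m : M,
      ((PowerSeries.X : PowerSeries ℤ_[p]) ^ n) • m = 0 →
      ((p : PowerSeries ℤ_[p]) ^ k) • m = 0 := by
  have : Finite (Submodule.torsionBy (PowerSeries ℤ_[p]) M PowerSeries.X) := hfin
  obtain ⟨a, ha⟩ := exists_pow_smul_eq_zero_of_finite p
    (Submodule.torsionBy (PowerSeries ℤ_[p]) M PowerSeries.X)
  have hX : ∀ m : M, (PowerSeries.X : PowerSeries ℤ_[p]) • m = 0 →
      ((p : PowerSeries ℤ_[p]) ^ a) • m = 0 :=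
    fun m hm => congrArg Subtype.val (ha ⟨m, hm⟩)
  let T : ℕ →o Submodule (PowerSeries ℤ_[p]) M :=
    ⟨fun n => Submodule.torsionBy _ M (PowerSeries.X ^ n),
      fun _ _ hij => Submodule.torsionBy_le_torsionBy_of_dvd _ _ (pow_dvd_pow _ hij)⟩
  have : IsNoetherian (PowerSeries ℤ_[p]) M := isNoetherian_of_isNoetherianRing_of_finite _ M
  obtain ⟨n₀, hn₀⟩ := monotone_stabilizes_iff_noetherian.mpr this T
  refine ⟨a * n₀, fun n _ m hm => ?_⟩
  have hmem : m ∈ T n₀ := by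
    rw [hn₀ (max n n₀) (le_max_right _ _)]
    exact T.monotone (le_max_left n n₀) hm
  rw [pow_mul]
  exact pow_smul_eq_zero_of_pow_smul_eq_zero hX n₀ m hmem
end

section
/- Let p be a prime, let A be a compact open subset of ℤ_p × ℤ_p such that A ∩ p(ℤ_p × ℤ_p) = ∅ (equivalently, every (x,y) ∈ A has x or y a p-adic unit), and let j ≥ 1 be an integer. Let C(A) denote the ℚ_p-vector space of continuous functions A → ℚ_p, and let x̂, ŷ ∈ C(A) be the restrictions to A of the two coordinate functions. Define ℚ_p-linear maps α : C(A)^j → C(A)^{j+1} by α(f₀,…,f_{j−1}) = (−ŷ·f₀, x̂·f₀ − ŷ·f₁, …, x̂·f_{j−2} − ŷ·f_{j−1}, x̂·f_{j−1}), and β : C(A)^{j+1} → C(A) by β(f₀,…,f_j) = x̂^j·f₀ + x̂^{j−1}ŷ·f₁ + … + ŷ^j·f_j. Then the sequence 0 → C(A)^j → C(A)^{j+1} → C(A) → 0 is exact: α is injective, β is surjective, and the kernel of β equals the image of α. -/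
namespace ClebschGordan

variable {R : Type*} [CommRing R] {n : ℕ}

theorem pred_val_lt (i : Fin (n + 1)) (h : 0 < (i : ℕ)) : (i : ℕ) - 1 < n := by
  omega

/-- The map `(f₀,…,f_{n-1}) ↦ (-y f₀, x f₀ - y f₁, …, x f_{n-1})`. -/
def left (x y : R) (n : ℕ) : (Fin n → R) →ₗ[R] (Fin (n + 1) → R) where
  toFun f i :=
    (if h : (i : ℕ) < n then -(y * f ⟨i, h⟩) else 0) +
      (if h : 0 < (i : ℕ) then x * f ⟨(i : ℕ) - 1, pred_val_lt i h⟩ else 0)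
  map_add' f g := by
    ext i
    simp only [Pi.add_apply]
    split_ifs <;> ring
  map_smul' c f := by
    ext i
    simp only [Pi.smul_apply, smul_eq_mul, RingHom.id_apply]
    split_ifs <;> ring

/-- The map `(f₀,…,fₙ) ↦ xⁿ f₀ + xⁿ⁻¹ y f₁ + … + yⁿ fₙ`. -/
def right (x y : R) (n : ℕ) (f : Fin (n + 1) → R) : R :=
  ∑ i : Fin (n + 1), x ^ (n - (i : ℕ)) * y ^ (i : ℕ) * f i

theorem left_apply_zero (x y : R) (f : Fin (n + 1) → R) :
    left x y (n + 1) f 0 = -(y * f 0) := by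
  simp [left]

theorem left_apply_last (x y : R) (f : Fin (n + 1) → R) :
    left x y (n + 1) f (Fin.last _) = x * f (Fin.last n) := by
  have h : (0 : ℕ) < (Fin.last (n + 1) : ℕ) := Nat.succ_pos n
  simp only [left, LinearMap.coe_mk, AddHom.coe_mk, Fin.val_last, lt_irrefl, dite_false, zero_add]
  exact dif_pos h

theorem left_apply_succ_castSucc (x y : R) (f : Fin (n + 1) → R) (i : Fin n) :
    left x y (n + 1) f i.succ.castSucc = x * f i.castSucc - y * f i.succ := by
  have h : (⟨(i : ℕ) + 1, by omega⟩ : Fin (n + 1)) = i.succ := rfl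
  have h' : (⟨(i : ℕ), by omega⟩ : Fin (n + 1)) = i.castSucc := rfl
  simp [left, h, h']
  ring

theorem left_single (x y : R) (i : Fin n) :
    left x y n (Pi.single i 1) =
      x • Pi.single i.succ (1 : R) - y • Pi.single i.castSucc (1 : R) := by
  ext k
  simp only [left, LinearMap.coe_mk, AddHom.coe_mk, Pi.sub_apply, Pi.smul_apply, smul_eq_mul,
    Pi.single_apply, Fin.ext_iff, Fin.val_succ, Fin.val_castSucc]
  have := i.isLt
  split_ifs <;> first | omega | ring

theorem right_left (x y : R) (f : Fin n → R) : right x y n (left x y n f) = 0 := by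
  have h₁ : right x y n (left x y n f) =
      (∑ i : Fin (n + 1), x ^ (n - (i : ℕ)) * y ^ (i : ℕ) *
        (if h : (i : ℕ) < n then -(y * f ⟨i, h⟩) else 0)) +
      ∑ i : Fin (n + 1), x ^ (n - (i : ℕ)) * y ^ (i : ℕ) *
        (if h : 0 < (i : ℕ) then x * f ⟨(i : ℕ) - 1, pred_val_lt i h⟩ else 0) := by
    simp only [right, left, LinearMap.coe_mk, AddHom.coe_mk, mul_add, Finset.sum_add_distrib]
  rw [h₁, Fin.sum_univ_castSucc, Fin.sum_univ_succ (n := n),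
    dif_neg (show ¬ 0 < ((0 : Fin (n + 1)) : ℕ) from lt_irrefl 0)]
  simp only [Fin.val_castSucc, Fin.is_lt, dite_true, Fin.val_last, lt_irrefl, dite_false,
    mul_zero, add_zero, zero_add, Fin.val_succ, Nat.succ_pos,
    Nat.add_sub_cancel, Fin.eta]
  rw [← Finset.sum_add_distrib]
  refine Finset.sum_eq_zero fun i _ => ?_
  obtain ⟨k, hk⟩ : ∃ k, n = i + 1 + k := ⟨n - (i + 1), by omega⟩
  rw [show n - (i : ℕ) = k + 1 by omega, show n - ((i : ℕ) + 1) = k by omega]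
  ring

theorem left_injective {x y : R} (hxy : IsCoprime x y) : Function.Injective (left x y n) := by
  rw [← LinearMap.ker_eq_bot, LinearMap.ker_eq_bot']
  intro f hf
  cases n with
  | zero => exact Subsingleton.elim _ _
  | succ n =>
    have hrec (i : Fin n) : x * f i.castSucc = y * f i.succ := by
      rw [← sub_eq_zero, ← left_apply_succ_castSucc, hf, Pi.zero_apply]
    have hy (i : Fin (n + 1)) : y ^ ((i : ℕ) + 1) * f i = 0 := by
      induction i using Fin.induction with
      | zero => simpa [hf] using (left_apply_zero x y f).symm
      | succ i ih =>
        rw [Fin.val_succ, pow_succ, mul_assoc, ← hrec, mul_left_comm]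
        simpa using congrArg (x * ·) ih
    have hx (i : Fin (n + 1)) : x ^ (n + 1 - (i : ℕ)) * f i = 0 := by
      induction i using Fin.reverseInduction with
      | last => simpa [hf] using (left_apply_last x y f).symm
      | cast i ih =>
        rw [Fin.val_castSucc, show n + 1 - (i : ℕ) = n + 1 - ((i : ℕ) + 1) + 1 by omega, pow_succ,
          mul_assoc, hrec, mul_left_comm]
        simpa using congrArg (y * ·) ih
    ext i
    obtain ⟨a, b, hab⟩ : IsCoprime (x ^ (n + 1 - (i : ℕ))) (y ^ ((i : ℕ) + 1)) := hxy.pow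
    rw [Pi.zero_apply]
    linear_combination a * hx i + b * hy i - f i * hab

theorem right_surjective {x y : R} (hxy : IsCoprime x y) (hn : n ≠ 0) :
    Function.Surjective (right x y n) := by
  intro h
  obtain ⟨n, rfl⟩ := Nat.exists_eq_succ_of_ne_zero hn
  obtain ⟨a, b, hab⟩ : IsCoprime (x ^ (n + 1)) (y ^ (n + 1)) := hxy.pow
  refine ⟨Pi.single 0 (a * h) + Pi.single (Fin.last _) (b * h), ?_⟩
  simp only [right, Pi.add_apply, mul_add, Finset.sum_add_distrib, Pi.single_apply, mul_ite,
    mul_zero, Finset.sum_ite_eq', Finset.mem_univ, if_true, Fin.val_zero, Fin.val_last,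
    Nat.sub_self, Nat.sub_zero, Nat.succ_eq_add_one, pow_zero]
  linear_combination h * hab

/-- Modulo the image of `left`, `y ^ (n - i) eᵢ` agrees with `x ^ (n - i) eₙ`. -/
theorem smul_single_sub_smul_single_last_mem (x y : R) (i : Fin (n + 1)) :
    y ^ (n - (i : ℕ)) • Pi.single i (1 : R) - x ^ (n - (i : ℕ)) • Pi.single (Fin.last n) (1 : R) ∈
      LinearMap.range (left x y n) := by
  induction i using Fin.reverseInduction with
  | last => simp
  | cast i ih =>
    have hmem := (LinearMap.range (left x y n)).sub_mem
      ((LinearMap.range (left x y n)).smul_mem x ih)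
      ((LinearMap.range (left x y n)).smul_mem (y ^ (n - ((i : ℕ) + 1)))
        ⟨Pi.single i 1, left_single x y i⟩)
    rw [Fin.val_succ] at hmem
    rw [Fin.val_castSucc, show n - (i : ℕ) = n - ((i : ℕ) + 1) + 1 by omega]
    convert hmem using 1
    module

/-- Modulo the image of `left`, `x ^ i eᵢ` agrees with `y ^ i e₀`. -/
theorem smul_single_sub_smul_single_zero_mem (x y : R) (i : Fin (n + 1)) :
    x ^ (i : ℕ) • Pi.single i (1 : R) - y ^ (i : ℕ) • Pi.single 0 (1 : R) ∈
      LinearMap.range (left x y n) := by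
  induction i using Fin.induction with
  | zero => simp
  | succ i ih =>
    have hmem := (LinearMap.range (left x y n)).add_mem
      ((LinearMap.range (left x y n)).smul_mem y ih)
      ((LinearMap.range (left x y n)).smul_mem (x ^ (i : ℕ))
        ⟨Pi.single i 1, left_single x y i⟩)
    rw [Fin.val_castSucc] at hmem
    rw [Fin.val_succ]
    convert hmem using 1
    module

theorem smul_eq_sum_smul_single (c : R) (f : Fin n → R) :
    c • f = ∑ i, (c * f i) • Pi.single i (1 : R) :=
  pi_eq_sum_univ' (c • f)

theorem mem_range_left {x y : R} (hxy : IsCoprime x y) {f : Fin (n + 1) → R}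
    (hf : right x y n f = 0) : f ∈ LinearMap.range (left x y n) := by
  have hy : y ^ n • f ∈ LinearMap.range (left x y n) := by
    have hmem := (LinearMap.range (left x y n)).sum_mem fun (i : Fin (n + 1)) (_ : i ∈ Finset.univ) =>
      (LinearMap.range (left x y n)).smul_mem (y ^ (i : ℕ) * f i)
        (smul_single_sub_smul_single_last_mem x y i)
    convert hmem using 1
    have h : ∑ i : Fin (n + 1), (x ^ (n - (i : ℕ)) * y ^ (i : ℕ) * f i) •
        Pi.single (Fin.last n) (1 : R) = 0 := by
      rw [← Finset.sum_smul, ← right, hf, zero_smul]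
    rw [← sub_zero (y ^ n • f), ← h]
    rw [smul_eq_sum_smul_single, ← Finset.sum_sub_distrib]
    refine Finset.sum_congr rfl fun i _ => ?_
    have hpow : y ^ n = y ^ (i : ℕ) * y ^ (n - (i : ℕ)) := by
      rw [← pow_add, Nat.add_sub_of_le (Nat.le_of_lt_succ i.isLt)]
    rw [hpow]
    module
  have hx : x ^ n • f ∈ LinearMap.range (left x y n) := by
    have hmem := (LinearMap.range (left x y n)).sum_mem fun (i : Fin (n + 1)) (_ : i ∈ Finset.univ) =>
      (LinearMap.range (left x y n)).smul_mem (x ^ (n - (i : ℕ)) * f i)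
        (smul_single_sub_smul_single_zero_mem x y i)
    convert hmem using 1
    have h : ∑ i : Fin (n + 1), (x ^ (n - (i : ℕ)) * y ^ (i : ℕ) * f i) •
        Pi.single (0 : Fin (n + 1)) (1 : R) = 0 := by
      rw [← Finset.sum_smul, ← right, hf, zero_smul]
    rw [← sub_zero (x ^ n • f), ← h]
    rw [smul_eq_sum_smul_single, ← Finset.sum_sub_distrib]
    refine Finset.sum_congr rfl fun i _ => ?_
    have hpow : x ^ n = x ^ (n - (i : ℕ)) * x ^ (i : ℕ) := by
      rw [← pow_add, Nat.sub_add_cancel (Nat.le_of_lt_succ i.isLt)]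
    rw [hpow]
    module
  obtain ⟨a, b, hab⟩ : IsCoprime (x ^ n) (y ^ n) := hxy.pow
  have hmem := (LinearMap.range (left x y n)).add_mem
    ((LinearMap.range (left x y n)).smul_mem a hx) ((LinearMap.range (left x y n)).smul_mem b hy)
  rwa [smul_smul, smul_smul, ← add_smul, hab, one_smul] at hmem

end ClebschGordan

/-- Two continuous functions with values in an ultrametric field are coprime as soon as at every
point one of them has norm one. -/
theorem ContinuousMap.isCoprime_of_norm_eq_one {X K : Type*} [TopologicalSpace X] [NormedField K]
    [IsUltrametricDist K] (f g : C(X, K)) (h : ∀ z, ‖f z‖ = 1 ∨ ‖g z‖ = 1) : IsCoprime f g := by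
  classical
  set U : Set X := f ⁻¹' Metric.sphere 0 1 with hU_def
  have hmem (z : X) : z ∈ U ↔ ‖f z‖ = 1 := by simp [hU_def]
  have hU : IsClopen U :=
    (IsUltrametricDist.isClopen_sphere (0 : K) one_ne_zero).preimage f.continuous
  have hf0 (z : X) (hz : z ∈ U) : f z ≠ 0 :=
    norm_ne_zero_iff.mp (by rw [(hmem z).mp hz]; exact one_ne_zero)
  have hg0 (z : X) (hz : z ∉ U) : g z ≠ 0 :=
    norm_ne_zero_iff.mp
      (by rw [(h z).resolve_left fun h' => hz ((hmem z).mpr h')]; exact one_ne_zero)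
  have hu : Continuous (U.piecewise (fun z => (f z)⁻¹) 0) :=
    continuous_piecewise (by simp [hU.frontier_eq])
      (by rw [hU.isClosed.closure_eq]; exact f.continuous.continuousOn.inv₀ hf0)
      continuousOn_const
  have hv : Continuous (U.piecewise 0 (fun z => (g z)⁻¹)) :=
    continuous_piecewise (by simp [hU.frontier_eq]) continuousOn_const
      (by rw [hU.compl.isClosed.closure_eq]; exact g.continuous.continuousOn.inv₀ hg0)
  refine ⟨⟨_, hu⟩, ⟨_, hv⟩, ContinuousMap.ext fun z => ?_⟩
  by_cases hz : z ∈ U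
  · simp [hz, hf0 z hz]
  · simp [hz, hg0 z hz]

theorem PadicInt.norm_eq_one_of_not_dvd {p : ℕ} [Fact p.Prime] {x : ℤ_[p]}
    (hx : ¬ (p : ℤ_[p]) ∣ x) : ‖x‖ = 1 :=
  (PadicInt.norm_le_one x).eq_of_not_lt fun h => hx (PadicInt.norm_lt_one_iff_dvd x |>.mp h)


/-- the coordinate form of the Clebsch–Gordan short exact sequence
`0 → C(A)^j → C(A)^{j+1} → C(A) → 0` for a compact open `A ⊆ ℤ_p × ℤ_p` avoiding
`p(ℤ_p × ℤ_p)`, where `α(f₀,…,f_{j−1}) = (−ŷf₀, x̂f₀ − ŷf₁, …, x̂f_{j−1})` and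
`β(f₀,…,f_j) = Σ x̂^{j−i} ŷ^i f_i`. -/
theorem clebsch_gordan_exact (p : ℕ) [Fact p.Prime] (j : ℕ) (hj : 1 ≤ j)
    (A : Set (ℤ_[p] × ℤ_[p])) (hAc : IsCompact A) (hAo : IsOpen A)
    (hAp : ∀ x y : ℤ_[p], ((p : ℤ_[p]) * x, (p : ℤ_[p]) * y) ∉ A)
    (xhat yhat : C(A, ℚ_[p]))
    (hx : ∀ z : A, xhat z = ((z : ℤ_[p] × ℤ_[p]).1 : ℚ_[p]))
    (hy : ∀ z : A, yhat z = ((z : ℤ_[p] × ℤ_[p]).2 : ℚ_[p]))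
    (α : (Fin j → C(A, ℚ_[p])) →ₗ[ℚ_[p]] (Fin (j + 1) → C(A, ℚ_[p])))
    (β : (Fin (j + 1) → C(A, ℚ_[p])) →ₗ[ℚ_[p]] C(A, ℚ_[p]))
    (hα : ∀ (f : Fin j → C(A, ℚ_[p])) (i : Fin (j + 1)),
      α f i =
        (if h : (i : ℕ) < j then -(yhat * f ⟨i, h⟩) else 0) +
        (if h : 0 < (i : ℕ) then
          xhat * f ⟨(i : ℕ) - 1, by have := i.isLt; omega⟩ else 0))
    (hβ : ∀ f : Fin (j + 1) → C(A, ℚ_[p]),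
      β f = ∑ i : Fin (j + 1), xhat ^ (j - (i : ℕ)) * yhat ^ (i : ℕ) * f i) :
    Function.Injective α ∧ Function.Surjective β ∧
      LinearMap.ker β = LinearMap.range α := by
  have hxy : IsCoprime xhat yhat := by
    refine xhat.isCoprime_of_norm_eq_one yhat fun z => ?_
    rw [hx, hy, PadicInt.padic_norm_e_of_padicInt, PadicInt.padic_norm_e_of_padicInt]
    by_contra! hz
    obtain ⟨a, ha⟩ := not_imp_comm.mp PadicInt.norm_eq_one_of_not_dvd hz.1
    obtain ⟨b, hb⟩ := not_imp_comm.mp PadicInt.norm_eq_one_of_not_dvd hz.2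
    refine hAp a b ?_
    rw [← ha, ← hb]
    exact z.2
  have hα' (f) : α f = ClebschGordan.left xhat yhat j f := funext (hα f)
  have hβ' (f) : β f = ClebschGordan.right xhat yhat j f := hβ f
  refine ⟨fun f g hfg => ClebschGordan.left_injective hxy (by rw [← hα', ← hα', hfg]),
    fun h => ?_, ?_⟩
  · obtain ⟨f, hf⟩ := ClebschGordan.right_surjective hxy (by omega : j ≠ 0) h
    exact ⟨f, (hβ' f).trans hf⟩
  · ext f
    rw [LinearMap.mem_ker, hβ', LinearMap.mem_range]
    constructor
    · intro hf
      obtain ⟨g, hg⟩ := ClebschGordan.mem_range_left hxy hf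
      exact ⟨g, (hα' g).trans hg⟩
    · rintro ⟨g, rfl⟩
      rw [hα', ClebschGordan.right_left]
end

section
/- Let p be a prime, let A be a compact open subset of ℤ_p × ℤ_p such that A ∩ p(ℤ_p × ℤ_p) = ∅ (equivalently, every (x,y) ∈ A has x or y a p-adic unit), and let j ≥ 1 be an integer. Let C(A) denote the Banach space of continuous functions A → ℚ_p with the supremum norm, let x̂, ŷ ∈ C(A) be the restrictions to A of the two coordinate functions, and let β : C(A)^{j+1} → C(A) be the map β(f₀,…,f_j) = x̂^j·f₀ + x̂^{j−1}ŷ·f₁ + … + ŷ^j·f_j. Then β admits a continuous ℚ_p-linear section: there exists a continuous ℚ_p-linear map s : C(A) → C(A)^{j+1} with β(s(f)) = f for all f ∈ C(A). -/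
/-- A continuous function that is nonzero on a clopen set `U` has a continuous inverse on `U`,
extended by zero. -/
theorem ContinuousMap.exists_mul_eq_indicator_of_isClopen {X K : Type*} [TopologicalSpace X]
    [DivisionRing K] [TopologicalSpace K] [ContinuousInv₀ K] {U : Set X} (hU : IsClopen U)
    (a : C(X, K)) (ha : ∀ z ∈ U, a z ≠ 0) :
    ∃ g : C(X, K), ∀ z, a z * g z = U.indicator 1 z := by
  classical
  refine ⟨⟨U.piecewise (fun z => (a z)⁻¹) 0, continuous_piecewise ?_ ?_ ?_⟩, fun z => ?_⟩
  · simp [hU.frontier_eq]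
  · rw [hU.isClosed.closure_eq]
    exact a.continuous.continuousOn.inv₀ ha
  · exact continuousOn_const
  · by_cases hz : z ∈ U
    · simp [hz, ha z hz]
    · simp [hz]

/-- Two continuous functions, one nonzero on a clopen set and the other nonzero on its
complement, generate the unit ideal. -/
theorem ContinuousMap.exists_mul_add_mul_eq_one_of_isClopen {X K : Type*} [TopologicalSpace X]
    [DivisionRing K] [TopologicalSpace K] [IsTopologicalRing K] [ContinuousInv₀ K] {U : Set X}
    (hU : IsClopen U) (a b : C(X, K)) (ha : ∀ z ∈ U, a z ≠ 0) (hb : ∀ z ∈ Uᶜ, b z ≠ 0) :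
    ∃ g h : C(X, K), a * g + b * h = 1 := by
  obtain ⟨g, hg⟩ := a.exists_mul_eq_indicator_of_isClopen hU ha
  obtain ⟨h, hh⟩ := b.exists_mul_eq_indicator_of_isClopen hU.compl hb
  refine ⟨g, h, ContinuousMap.ext fun z => ?_⟩
  simp only [ContinuousMap.add_apply, ContinuousMap.mul_apply, hg, hh, ContinuousMap.one_apply]
  by_cases hz : z ∈ U <;> simp [hz]


/-- the multiplication map `β(f₀,…,f_j) = Σ x̂^{j−i} ŷ^i f_i` of the
Clebsch–Gordan sequence admits a continuous `ℚ_p`-linear section. -/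
theorem clebsch_gordan_beta_section (p : ℕ) [Fact p.Prime] (j : ℕ) (hj : 1 ≤ j)
    (A : Set (ℤ_[p] × ℤ_[p])) (hAc : IsCompact A) (hAo : IsOpen A)
    (hAp : ∀ x y : ℤ_[p], ((p : ℤ_[p]) * x, (p : ℤ_[p]) * y) ∉ A)
    (xhat yhat : C(A, ℚ_[p]))
    (hx : ∀ z : A, xhat z = ((z : ℤ_[p] × ℤ_[p]).1 : ℚ_[p]))
    (hy : ∀ z : A, yhat z = ((z : ℤ_[p] × ℤ_[p]).2 : ℚ_[p]))
    (β : (Fin (j + 1) → C(A, ℚ_[p])) →ₗ[ℚ_[p]] C(A, ℚ_[p]))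
    (hβ : ∀ f : Fin (j + 1) → C(A, ℚ_[p]),
      β f = ∑ i : Fin (j + 1), xhat ^ (j - (i : ℕ)) * yhat ^ (i : ℕ) * f i) :
    ∃ s : C(A, ℚ_[p]) →L[ℚ_[p]] (Fin (j + 1) → C(A, ℚ_[p])),
      ∀ f : C(A, ℚ_[p]), β (s f) = f := by
  have : CompactSpace A := isCompact_iff_compactSpace.mp hAc
  have hU : IsClopen (xhat ⁻¹' Metric.sphere 0 1) :=
    (IsUltrametricDist.isClopen_sphere (0 : ℚ_[p]) one_ne_zero).preimage xhat.continuous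
  obtain ⟨g, h, hgh⟩ := ContinuousMap.exists_mul_add_mul_eq_one_of_isClopen hU
    (xhat ^ j) (yhat ^ j)
    (fun z hz => by
      have hz' : ‖xhat z‖ = 1 := by simpa using hz
      rw [ContinuousMap.pow_apply]
      exact pow_ne_zero _ (norm_ne_zero_iff.mp (hz' ▸ one_ne_zero)))
    (fun z hz h0 => by
      have hy0 : (z : ℤ_[p] × ℤ_[p]).2 = 0 := by
        rw [ContinuousMap.pow_apply] at h0
        simpa [hy] using eq_zero_of_pow_eq_zero h0
      have hx1 : ‖(z : ℤ_[p] × ℤ_[p]).1‖ < 1 :=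
        lt_of_le_of_ne (PadicInt.norm_le_one _) (by simpa [hx] using hz)
      obtain ⟨c, hc⟩ := PadicInt.norm_lt_one_iff_dvd _ |>.mp hx1
      refine hAp c 0 ?_
      rw [← hc, mul_zero, ← hy0]
      exact z.2)
  have hne : (0 : Fin (j + 1)) ≠ Fin.last j := by
    simp [Fin.ext_iff]; omega
  let mulCLM (u : C(A, ℚ_[p])) : C(A, ℚ_[p]) →L[ℚ_[p]] C(A, ℚ_[p]) :=
    ⟨LinearMap.mulLeft ℚ_[p] u, continuous_const_mul u⟩
  refine ⟨(ContinuousLinearMap.single ℚ_[p] (fun _ => C(A, ℚ_[p])) 0).comp (mulCLM g) +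
    (ContinuousLinearMap.single ℚ_[p] (fun _ => C(A, ℚ_[p])) (Fin.last j)).comp (mulCLM h),
    fun f => ?_⟩
  have key (i : Fin (j + 1)) (u : C(A, ℚ_[p])) :
      β (Pi.single i u) = xhat ^ (j - (i : ℕ)) * yhat ^ (i : ℕ) * u := by
    rw [hβ, Finset.sum_eq_single i] <;> simp +contextual
  change β (Pi.single 0 (g * f) + Pi.single (Fin.last j) (h * f)) = f
  rw [map_add, key, key]
  simp only [Fin.val_zero, Fin.val_last, Nat.sub_zero, Nat.sub_self, pow_zero, mul_one, one_mul]
  rw [← mul_assoc, ← mul_assoc, ← add_mul, hgh, one_mul]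
end

section
/- Let k, j be natural numbers and let f ∈ ℚ[x,y] be a homogeneous polynomial of total degree k. Then Σ_{s=0}^{j} C(j,s) · x^s y^{j−s} · ∂_x^s ∂_y^{j−s}(f) = j! · C(k,j) · f, where C(·,·) denotes binomial coefficients and ∂_x, ∂_y are the formal partial derivatives. In particular, if k < j the left-hand side vanishes. -/
theorem Nat.sum_choose_mul_descFactorial_mul_descFactorial (a b j : ℕ) :
    ∑ s ∈ Finset.range (j + 1), j.choose s * (a.descFactorial s * b.descFactorial (j - s)) =
      j.factorial * (a + b).choose j := by
  rw [Nat.add_choose_eq, Finset.Nat.sum_antidiagonal_eq_sum_range_succ_mk, Finset.mul_sum]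
  refine Finset.sum_congr rfl fun s hs => ?_
  rw [Nat.descFactorial_eq_factorial_mul_choose, Nat.descFactorial_eq_factorial_mul_choose,
    ← Nat.choose_mul_factorial_mul_factorial (Finset.mem_range_succ_iff.mp hs)]
  ring

namespace MvPolynomial

variable {σ R : Type*} [CommSemiring R]

theorem iterate_pderiv_monomial (i : σ) (n : ℕ) (m : σ →₀ ℕ) (r : R) :
    (⇑(pderiv i))^[n] (monomial m r) =
      monomial (m - Finsupp.single i n) (r * ((m i).descFactorial n : R)) := by
  induction n with
  | zero => simp
  | succ n ih =>
    rw [Function.iterate_succ_apply', ih, pderiv_monomial, tsub_tsub, ← Finsupp.single_add]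
    simp [Nat.descFactorial_succ, mul_left_comm, mul_comm]

theorem X_pow_mul_iterate_pderiv_monomial (i : σ) (n : ℕ) (m : σ →₀ ℕ) (r : R) :
    X i ^ n * (⇑(pderiv i))^[n] (monomial m r) =
      ((m i).descFactorial n : MvPolynomial σ R) * monomial m r := by
  rw [iterate_pderiv_monomial, X_pow_eq_monomial, monomial_mul, ← C_eq_coe_nat, C_mul_monomial,
    one_mul, mul_comm r]
  rcases lt_or_ge (m i) n with h | h
  · simp [Nat.descFactorial_of_lt h]
  · rw [add_tsub_cancel_of_le (Finsupp.single_le_iff.mpr h)]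

theorem X_pow_mul_X_pow_mul_iterate_pderiv_monomial {i k : σ} (hik : i ≠ k) (s t : ℕ)
    (m : σ →₀ ℕ) (r : R) :
    X i ^ s * X k ^ t * (⇑(pderiv i))^[s] ((⇑(pderiv k))^[t] (monomial m r)) =
      (((m i).descFactorial s * (m k).descFactorial t : ℕ) : MvPolynomial σ R) * monomial m r := by
  rw [mul_right_comm, iterate_pderiv_monomial k, X_pow_mul_iterate_pderiv_monomial,
    ← iterate_pderiv_monomial, mul_assoc, mul_comm _ (X k ^ t), X_pow_mul_iterate_pderiv_monomial]
  simp [hik, mul_assoc]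

theorem sum_X_pow_mul_iterate_pderiv_of_isHomogeneous {f : MvPolynomial (Fin 2) R} {k : ℕ}
    (hf : f.IsHomogeneous k) (j : ℕ) :
    ∑ s ∈ Finset.range (j + 1),
        (j.choose s : MvPolynomial (Fin 2) R) * X 0 ^ s * X 1 ^ (j - s) *
          (⇑(pderiv (0 : Fin 2)))^[s] ((⇑(pderiv (1 : Fin 2)))^[j - s] f) =
      (j.factorial : MvPolynomial (Fin 2) R) * (k.choose j : MvPolynomial (Fin 2) R) * f := by
  conv_lhs => rw [f.as_sum]
  conv_rhs => rw [f.as_sum]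
  simp only [← Derivation.coeFn_coe, ← Module.End.coe_pow, map_sum, Finset.mul_sum]
  rw [Finset.sum_comm]
  refine Finset.sum_congr rfl fun m hm => ?_
  have hk : m 0 + m 1 = k := by
    rw [← Fin.sum_univ_two, ← Finsupp.degree_eq_sum, Finsupp.degree_eq_weight_one]
    exact hf (mem_support_iff.mp hm)
  simp only [Module.End.coe_pow, Derivation.coeFn_coe]
  rw [← hk, ← Nat.cast_mul, ← Nat.sum_choose_mul_descFactorial_mul_descFactorial, Nat.cast_sum,
    Finset.sum_mul]
  refine Finset.sum_congr rfl fun s _ => ?_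
  rw [mul_assoc (_ : MvPolynomial (Fin 2) R) (X 0 ^ s), mul_assoc (j.choose s : MvPolynomial _ R),
    X_pow_mul_X_pow_mul_iterate_pderiv_monomial (by decide), Nat.cast_mul (j.choose s), mul_assoc]

end MvPolynomial


open MvPolynomial in
/-- for a homogeneous polynomial `f` of degree `k` in two variables,
`Σ_{s=0}^{j} C(j,s) x^s y^{j−s} ∂_x^s ∂_y^{j−s} f = j! C(k,j) f`; in particular the
left-hand side vanishes when `k < j`. -/
theorem euler_operator_on_homogeneous (k j : ℕ)
    (f : MvPolynomial (Fin 2) ℚ) (hf : f.IsHomogeneous k) :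
    (∑ s ∈ Finset.range (j + 1),
        (Nat.choose j s : MvPolynomial (Fin 2) ℚ) *
          X 0 ^ s * X 1 ^ (j - s) *
          ((⇑(pderiv (0 : Fin 2)))^[s] ((⇑(pderiv (1 : Fin 2)))^[j - s] f))) =
      (Nat.factorial j : MvPolynomial (Fin 2) ℚ) *
        (Nat.choose k j : MvPolynomial (Fin 2) ℚ) * f ∧
    (k < j →
      (∑ s ∈ Finset.range (j + 1),
        (Nat.choose j s : MvPolynomial (Fin 2) ℚ) *
          X 0 ^ s * X 1 ^ (j - s) *
          ((⇑(pderiv (0 : Fin 2)))^[s] ((⇑(pderiv (1 : Fin 2)))^[j - s] f))) = 0) := by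
  have h := sum_X_pow_mul_iterate_pderiv_of_isHomogeneous hf j
  exact ⟨h, fun hkj => by rw [h, Nat.choose_eq_zero_of_lt hkj]; simp⟩
end
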